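/- For every integer B ≥ 1, the quantity f(B) satisfies B/4 ≤ f(B) ≤ (1 + √(4/5))·B. -/

import Mathlib

/-- The points `0, {θ}, {2θ}, …, {Nθ}, 1` used in the three-gap theorem. -/
def gapPoints (θ : ℝ) (N : ℕ) : Set ℝ :=
  insert 1 {x : ℝ | ∃ k : ℕ, k ≤ N ∧ x = Int.fract (k * θ)}

/-- The gap set `G(θ, N)`: the set of differences between consecutive points among
`0, {θ}, {2θ}, …, {Nθ}, 1` sorted in ascending order. -/
def gapSet (θ : ℝ) (N : ℕ) : Set ℝ :=
  {d : ℝ | ∃ a ∈ gapPoints θ N, ∃ b ∈ gapPoints θ N,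
    a < b ∧ (∀ c ∈ gapPoints θ N, ¬(a < c ∧ c < b)) ∧ d = b - a}

/-- `H(θ, N)`, the largest gap in the gap set `G(θ, N)`. -/
noncomputable def maxGap (θ : ℝ) (N : ℕ) : ℝ := sSup (gapSet θ N)

/-- `θ` has all partial quotients `a_i` (for `i ≥ 1`) of its simple continued fraction
expansion bounded by `B`.  (Index `i` of `partDens` corresponds to `a_{i+1}`.) -/
def PartQuotBounded (θ : ℝ) (B : ℕ) : Prop :=
  ∀ i : ℕ, ∀ a ∈ ((GenContFract.of θ).partDens.get? i), a ≤ (B : ℝ)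

/-- `S_B`: the set of irrational numbers in `(0,1)` with partial quotients bounded by `B`. -/
def SB (B : ℕ) : Set ℝ :=
  {θ : ℝ | Irrational θ ∧ θ ∈ Set.Ioo (0 : ℝ) 1 ∧ PartQuotBounded θ B}

/-- `f(B) = sup_{θ ∈ S_B} sup_{N ≥ 1} N · H(θ, N)`. -/
noncomputable def badF (B : ℕ) : ℝ :=
  sSup {x : ℝ | ∃ θ ∈ SB B, ∃ N : ℕ, 1 ≤ N ∧ x = (N : ℝ) * maxGap θ N}

/-- The orbit of `θ` under the Gauss map `x ↦ {1/x}`. -/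
noncomputable def gaussIter (θ : ℝ) : ℕ → ℝ
  | 0 => θ
  | n + 1 => Int.fract (gaussIter θ n)⁻¹

/-- The partial quotients of `θ ∈ (0,1)`, where index `n` stands for `a_{n+1}`. -/
noncomputable def partQuot (θ : ℝ) (n : ℕ) : ℕ := ⌊(gaussIter θ n)⁻¹⌋₊

/-- The denominators of the convergents, where index `n` stands for `q_{n-1}`. -/
noncomputable def convDenom (θ : ℝ) : ℕ → ℕ
  | 0 => 0
  | 1 => 1
  | n + 2 => partQuot θ n * convDenom θ (n + 1) + convDenom θ n

/-- The approximation errors `|q_{n-1} θ - p_{n-1}|`. -/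
noncomputable def convErr (θ : ℝ) : ℕ → ℝ
  | 0 => 1
  | n + 1 => gaussIter θ n * convErr θ n

section GaussMap

variable {θ : ℝ}

lemma gaussIter_irrational_and_mem (hθ : Irrational θ) (h01 : θ ∈ Set.Ioo (0 : ℝ) 1) (n : ℕ) :
    Irrational (gaussIter θ n) ∧ gaussIter θ n ∈ Set.Ioo (0 : ℝ) 1 := by
  induction n with
  | zero => exact ⟨hθ, h01⟩
  | succ n ih =>
    have hirr : Irrational (gaussIter θ (n + 1)) := ih.1.inv.sub_intCast _
    exact ⟨hirr, (Int.fract_nonneg _).lt_of_ne hirr.ne_zero.symm, Int.fract_lt_one _⟩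

lemma partQuot_pos (hθ : Irrational θ) (h01 : θ ∈ Set.Ioo (0 : ℝ) 1) (n : ℕ) :
    1 ≤ partQuot θ n := by
  obtain ⟨-, h0, h1⟩ := gaussIter_irrational_and_mem hθ h01 n
  exact Nat.le_floor (by simpa using (one_le_inv₀ h0).2 h1.le)

lemma inv_gaussIter (hθ : Irrational θ) (h01 : θ ∈ Set.Ioo (0 : ℝ) 1) (n : ℕ) :
    (gaussIter θ n)⁻¹ = partQuot θ n + gaussIter θ (n + 1) := by
  obtain ⟨-, h0, -⟩ := gaussIter_irrational_and_mem hθ h01 n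
  rw [partQuot, natCast_floor_eq_intCast_floor (inv_nonneg.2 h0.le), gaussIter,
    Int.floor_add_fract]

lemma partDens_get?_eq_partQuot (hθ : Irrational θ) (h01 : θ ∈ Set.Ioo (0 : ℝ) 1) (n : ℕ) :
    (GenContFract.of θ).partDens.get? n = some (partQuot θ n : ℝ) := by
  have hstream (k : ℕ) : ∃ b, GenContFract.IntFractPair.stream θ k = some ⟨b, gaussIter θ k⟩ := by
    induction k with
    | zero =>
      refine ⟨⌊θ⌋, ?_⟩
      rw [GenContFract.IntFractPair.stream_zero, GenContFract.IntFractPair.of, gaussIter,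
        Int.fract_eq_self.2 ⟨h01.1.le, h01.2⟩]
    | succ k ih =>
      obtain ⟨b, hb⟩ := ih
      exact ⟨_, GenContFract.IntFractPair.stream_succ_of_some hb
        (gaussIter_irrational_and_mem hθ h01 k).1.ne_zero⟩
  obtain ⟨b, hb⟩ := hstream n
  obtain ⟨-, h0, -⟩ := gaussIter_irrational_and_mem hθ h01 n
  have hs := GenContFract.get?_of_eq_some_of_succ_get?_intFractPair_stream
    (GenContFract.IntFractPair.stream_succ_of_some hb h0.ne')
  rw [GenContFract.partDen_eq_s_b hs, partQuot,
    natCast_floor_eq_intCast_floor (inv_nonneg.2 h0.le)]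
  rfl

lemma PartQuotBounded.partQuot_le {B : ℕ} (h : PartQuotBounded θ B) (hθ : Irrational θ)
    (h01 : θ ∈ Set.Ioo (0 : ℝ) 1) (n : ℕ) : partQuot θ n ≤ B := by
  have := h n (partQuot θ n) (by rw [partDens_get?_eq_partQuot hθ h01]; rfl)
  exact_mod_cast this

lemma convErr_pos (hθ : Irrational θ) (h01 : θ ∈ Set.Ioo (0 : ℝ) 1) (n : ℕ) :
    0 < convErr θ n := by
  induction n with
  | zero => exact one_pos
  | succ n ih => exact mul_pos (gaussIter_irrational_and_mem hθ h01 n).2.1 ih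

lemma convErr_succ_lt (hθ : Irrational θ) (h01 : θ ∈ Set.Ioo (0 : ℝ) 1) (n : ℕ) :
    convErr θ (n + 1) < convErr θ n :=
  mul_lt_of_lt_one_left (convErr_pos hθ h01 n) (gaussIter_irrational_and_mem hθ h01 n).2.2

lemma convErr_eq (hθ : Irrational θ) (h01 : θ ∈ Set.Ioo (0 : ℝ) 1) (n : ℕ) :
    convErr θ n = partQuot θ n * convErr θ (n + 1) + convErr θ (n + 2) := by
  have h0 := (gaussIter_irrational_and_mem hθ h01 n).2.1
  have h : gaussIter θ n * (partQuot θ n + gaussIter θ (n + 1)) = 1 := by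
    rw [← inv_gaussIter hθ h01, mul_inv_cancel₀ h0.ne']
  simp only [convErr]
  linear_combination -convErr θ n * h

lemma convDenom_succ_pos (hθ : Irrational θ) (h01 : θ ∈ Set.Ioo (0 : ℝ) 1) (n : ℕ) :
    1 ≤ convDenom θ (n + 1) := by
  induction n with
  | zero => exact le_rfl
  | succ n ih => exact le_add_right (Nat.mul_pos (partQuot_pos hθ h01 n) ih)

lemma convDenom_le_succ (hθ : Irrational θ) (h01 : θ ∈ Set.Ioo (0 : ℝ) 1) (n : ℕ) :
    convDenom θ n ≤ convDenom θ (n + 1) := by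
  cases n with
  | zero => exact zero_le_one
  | succ n => exact le_add_right (Nat.le_mul_of_pos_left _ (partQuot_pos hθ h01 n))

lemma convDenom_mul_convErr (hθ : Irrational θ) (h01 : θ ∈ Set.Ioo (0 : ℝ) 1) (n : ℕ) :
    convDenom θ (n + 1) * convErr θ n + convDenom θ n * convErr θ (n + 1) = 1 := by
  induction n with
  | zero => simp [convDenom, convErr]
  | succ n ih =>
    rw [convDenom]
    push_cast
    linear_combination ih - convDenom θ (n + 1) * convErr_eq hθ h01 n

lemma exists_convDenom_mul_eq (hθ : Irrational θ) (h01 : θ ∈ Set.Ioo (0 : ℝ) 1) (n : ℕ) :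
    ∃ p : ℤ, convDenom θ n * θ = p - (-1) ^ n * convErr θ n := by
  suffices h : (∃ p : ℤ, convDenom θ n * θ = p - (-1) ^ n * convErr θ n) ∧
      ∃ p : ℤ, convDenom θ (n + 1) * θ = p - (-1) ^ (n + 1) * convErr θ (n + 1) from h.1
  induction n with
  | zero => exact ⟨⟨1, by simp [convDenom, convErr]⟩, 0, by simp [convDenom, convErr, gaussIter]⟩
  | succ n ih =>
    obtain ⟨⟨p, hp⟩, r, hr⟩ := ih
    refine ⟨⟨r, hr⟩, partQuot θ n * r + p, ?_⟩
    rw [convDenom]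
    push_cast
    linear_combination partQuot θ n * hr + hp - (-1) ^ n * convErr_eq hθ h01 n

/-- Every `M ≥ 1` lies between consecutive intermediate denominators `m q_n + q_{n-1}`. -/
lemma exists_intermediate_denom (hθ : Irrational θ) (h01 : θ ∈ Set.Ioo (0 : ℝ) 1) {M : ℕ}
    (hM : 1 ≤ M) : ∃ n m, 1 ≤ m ∧ m ≤ partQuot θ n ∧
      m * convDenom θ (n + 1) + convDenom θ n ≤ M ∧
      M < (m + 1) * convDenom θ (n + 1) + convDenom θ n := by
  have hgrow (n : ℕ) : n < convDenom θ (n + 1) + convDenom θ n := by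
    induction n with
    | zero => simp [convDenom]
    | succ n ih =>
      have h1 := convDenom_succ_pos hθ h01 n
      have h2 := Nat.le_mul_of_pos_left (convDenom θ (n + 1)) (partQuot_pos hθ h01 n)
      rw [convDenom]
      omega
  have hex : ∃ n, M < convDenom θ (n + 2) + convDenom θ (n + 1) :=
    ⟨M, (Nat.lt_succ_self M).trans (hgrow (M + 1))⟩
  classical
  set n := Nat.find hex
  have hlow : convDenom θ (n + 1) + convDenom θ n ≤ M := by
    rcases Nat.eq_zero_or_pos n with h | h
    · rw [h]; simpa [convDenom] using hM
    · have := Nat.find_min hex (m := n - 1) (by omega)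
      rw [show n - 1 + 2 = n + 1 by omega, show n - 1 + 1 = n by omega] at this
      omega
  have hup : M < convDenom θ (n + 2) + convDenom θ (n + 1) := Nat.find_spec hex
  have hq := convDenom_succ_pos hθ h01 n
  have hdiv := Nat.div_add_mod (M - convDenom θ n) (convDenom θ (n + 1))
  have hmod := Nat.mod_lt (M - convDenom θ n) hq
  rw [mul_comm] at hdiv
  refine ⟨n, (M - convDenom θ n) / convDenom θ (n + 1), ?_, ?_, ?_, ?_⟩
  · exact (Nat.one_le_div_iff hq).2 (by omega)
  · rw [← Nat.lt_succ_iff, Nat.div_lt_iff_lt_mul hq, Nat.succ_mul]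
    rw [convDenom] at hup
    omega
  · omega
  · rw [add_mul]
    omega

end GaussMap

section Gaps

variable {θ : ℝ} {N : ℕ}

lemma mem_Icc_of_mem_gapPoints {x : ℝ} (hx : x ∈ gapPoints θ N) : x ∈ Set.Icc (0 : ℝ) 1 := by
  rcases hx with rfl | ⟨k, -, rfl⟩
  · simp
  · exact ⟨Int.fract_nonneg _, (Int.fract_lt_one _).le⟩

/-- If `s θ ≡ δ` and `t θ ≡ -ε` modulo `1` and `s + t ≤ N + 1`, every point has a successor at
distance at most `max δ ε`. -/
lemma gap_le_max {s t : ℕ} {δ ε d : ℝ} {p r : ℤ} (hδ : 0 < δ) (hε : 0 < ε)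
    (hs : s * θ = p + δ) (ht : t * θ = r - ε) (hN : s + t ≤ N + 1) (hd : d ∈ gapSet θ N) :
    d ≤ max δ ε := by
  obtain ⟨a, ha, b, hb, hab, hgap, rfl⟩ := hd
  have hb1 := (mem_Icc_of_mem_gapPoints hb).2
  rcases ha with rfl | ⟨i, hi, rfl⟩
  · exact absurd hab hb1.not_gt
  have step {j : ℕ} {η : ℝ} {l : ℤ} (hη : 0 < η) (hj : j ≤ N) (hjl : j * θ = i * θ + l + η) :
      b - Int.fract (i * θ) ≤ η := by
    rcases lt_or_ge (Int.fract (i * θ) + η) 1 with h | h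
    · have hfr : Int.fract (j * θ) = Int.fract (i * θ) + η := by
        rw [Int.fract_eq_iff]
        refine ⟨add_nonneg (Int.fract_nonneg _) hη.le, h, ⌊i * θ⌋ + l, ?_⟩
        have := Int.floor_add_fract (i * θ)
        push_cast
        linear_combination hjl - this
      have := hgap _ (Or.inr ⟨j, hj, rfl⟩)
      rw [hfr] at this
      by_contra! hlt
      exact this ⟨by linarith, by linarith⟩
    · linarith
  rcases le_or_gt (i + s) N with h | h
  · refine (step (j := i + s) (l := p) hδ h ?_).trans (le_max_left _ _)
    push_cast
    linear_combination hs
  · refine (step (j := i - t) (l := -r) hε (by omega) ?_).trans (le_max_right _ _)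
    rw [Nat.cast_sub (by omega)]
    push_cast
    linear_combination -ht

lemma maxGap_le {D : ℝ} (hD : 0 ≤ D) (h : ∀ d ∈ gapSet θ N, d ≤ D) : maxGap θ N ≤ D :=
  Real.sSup_le h hD

lemma maxGap_le_convErr (hθ : Irrational θ) (h01 : θ ∈ Set.Ioo (0 : ℝ) 1) {n m : ℕ} (hm : 1 ≤ m)
    (hma : m ≤ partQuot θ n) (hN : m * convDenom θ (n + 1) + convDenom θ n ≤ N + 1) :
    maxGap θ N ≤ convErr θ n - (m - 1) * convErr θ (n + 1) := by
  obtain ⟨m, rfl⟩ := Nat.exists_eq_add_of_le' hm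
  push_cast
  rw [add_sub_cancel_right]
  have h1 := convErr_pos hθ h01 (n + 1)
  have hle : convErr θ (n + 1) ≤ convErr θ n - m * convErr θ (n + 1) := by
    have h2 := convErr_pos hθ h01 (n + 2)
    have hma' : (m : ℝ) + 1 ≤ partQuot θ n := by exact_mod_cast hma
    rw [convErr_eq hθ h01 n]
    nlinarith
  refine maxGap_le (h1.le.trans hle) fun d hd => ?_
  obtain ⟨p, hp⟩ := exists_convDenom_mul_eq hθ h01 n
  obtain ⟨r, hr⟩ := exists_convDenom_mul_eq hθ h01 (n + 1)
  rw [add_one_mul] at hN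
  rcases Nat.even_or_odd n with hn | hn
  · rw [hn.neg_one_pow] at hp
    rw [hn.add_one.neg_one_pow] at hr
    refine (gap_le_max (s := convDenom θ (n + 1))
      (t := m * convDenom θ (n + 1) + convDenom θ n) (p := r) (r := m * r + p) h1
      (h1.trans_le hle) ?_ ?_ (by omega) hd).trans_eq (max_eq_right hle)
    · linear_combination hr
    · push_cast
      linear_combination m * hr + hp
  · rw [hn.neg_one_pow] at hp
    rw [hn.add_one.neg_one_pow] at hr
    refine (gap_le_max (s := m * convDenom θ (n + 1) + convDenom θ n)
      (t := convDenom θ (n + 1)) (p := m * r + p) (r := r) (h1.trans_le hle) h1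
      ?_ ?_ (by omega) hd).trans_eq (max_eq_left hle)
    · push_cast
      linear_combination m * hr + hp
    · linear_combination hr

lemma one_sub_mul_le_maxGap (h0 : 0 < θ) (hN : N * θ < 1) : 1 - N * θ ≤ maxGap θ N := by
  have hfr {k : ℕ} (hk : k ≤ N) : Int.fract (k * θ) = k * θ := by
    have : (k : ℝ) * θ ≤ N * θ := by gcongr
    exact Int.fract_eq_self.2 ⟨by positivity, by linarith⟩
  refine le_csSup ⟨1, ?_⟩ ⟨N * θ, Or.inr ⟨N, le_rfl, (hfr le_rfl).symm⟩, 1, Or.inl rfl, hN, ?_, rfl⟩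
  · rintro d ⟨a, ha, b, hb, -, -, rfl⟩
    linarith [(mem_Icc_of_mem_gapPoints ha).1, (mem_Icc_of_mem_gapPoints hb).2]
  · rintro c (rfl | ⟨k, hk, rfl⟩) ⟨h1, h2⟩
    · exact lt_irrefl _ h2
    · rw [hfr hk] at h1
      have : (k : ℝ) * θ ≤ N * θ := by gcongr
      linarith

end Gaps

section UpperBound

variable {θ : ℝ} {B N : ℕ}

lemma mul_maxGap_le_of_two_le (hB : 2 ≤ B) (hθ : θ ∈ SB B) :
    N * maxGap θ N ≤ 3 / 2 * B := by
  obtain ⟨hirr, h01, hbd⟩ := hθ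
  obtain ⟨n, m, hm, hma, hlow, hup⟩ := exists_intermediate_denom hirr h01 (M := N + 1) (by omega)
  have hH := maxGap_le_convErr hirr h01 hm hma hlow
  have hAB := hbd.partQuot_le hirr h01 n
  have hqq := convDenom_le_succ hirr h01 n
  have he1 := convErr_pos hirr h01 (n + 1)
  have he2 := convErr_pos hirr h01 (n + 2)
  have hlt := convErr_succ_lt hirr h01 (n + 1)
  have heq := convErr_eq hirr h01 n
  have hdet := convDenom_mul_convErr hirr h01 n
  have hN : (N : ℝ) ≤ (m + 2) * convDenom θ (n + 1) := by
    have : N ≤ (m + 2) * convDenom θ (n + 1) := by linarith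
    exact_mod_cast this
  generalize partQuot θ n = A at *
  generalize convErr θ (n + 2) = e₂ at *
  generalize convErr θ (n + 1) = e₁ at *
  generalize convErr θ n = e₀ at *
  generalize convDenom θ (n + 1) = q₁ at *
  generalize convDenom θ n = q₀ at *
  have hm' : (1 : ℝ) ≤ m := by exact_mod_cast hm
  have hma' : (m : ℝ) ≤ A := by exact_mod_cast hma
  have hAB' : (A : ℝ) ≤ B := by exact_mod_cast hAB
  have hB' : (2 : ℝ) ≤ B := by exact_mod_cast hB
  have hqe : (q₁ : ℝ) * e₀ ≤ 1 := by
    have : 0 ≤ (q₀ : ℝ) * e₁ := by positivity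
    linarith
  have hgap : (A + 1) * (e₀ - (m - 1) * e₁) ≤ (A - m + 2) * e₀ := by
    rw [heq]
    nlinarith [mul_nonneg (sub_nonneg.2 hm') (sub_nonneg.2 hlt.le)]
  have hD : 0 ≤ e₀ - (m - 1) * e₁ := by rw [heq]; nlinarith
  have hmain : (A + 1) * (N * maxGap θ N) ≤ (m + 2) * (A - m + 2) :=
    calc (A + 1) * (N * maxGap θ N) ≤ (A + 1) * (N * (e₀ - (m - 1) * e₁)) := by gcongr
      _ ≤ (A + 1) * (((m + 2) * q₁) * (e₀ - (m - 1) * e₁)) := by gcongr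
      _ = (m + 2) * q₁ * ((A + 1) * (e₀ - (m - 1) * e₁)) := by ring
      _ ≤ (m + 2) * q₁ * ((A - m + 2) * e₀) := by gcongr
      _ = (m + 2) * (A - m + 2) * (q₁ * e₀) := by ring
      _ ≤ (m + 2) * (A - m + 2) * 1 := by
        gcongr
      _ = (m + 2) * (A - m + 2) := mul_one _
  have hfin : ((m : ℝ) + 2) * (A - m + 2) ≤ (A + 1) * (3 / 2 * B) := by
    rcases (show A = 1 ∨ 2 ≤ A by omega) with rfl | hA
    · obtain rfl : m = 1 := by omega
      norm_num
      linarith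
    · have hA' : (2 : ℝ) ≤ A := by exact_mod_cast hA
      nlinarith [sq_nonneg ((A : ℝ) - 2 * m)]
  exact le_of_mul_le_mul_left (hmain.trans hfin) (by linarith)

lemma gaussIter_eq_of_partQuot_eq_one {g : ℝ} (hg : g ∈ Set.Ioo (0 : ℝ) 1) (hg2 : g * (1 + g) = 1)
    (hθ : Irrational θ) (h01 : θ ∈ Set.Ioo (0 : ℝ) 1) (ha : ∀ n, partQuot θ n = 1) (n : ℕ) :
    gaussIter θ n = g := by
  have hbound (k : ℕ) : ∀ n, |gaussIter θ n - g| ≤ g ^ k := by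
    induction k with
    | zero =>
      intro n
      obtain ⟨-, h0, h1⟩ := gaussIter_irrational_and_mem hθ h01 n
      rw [pow_zero, abs_le]
      constructor <;> linarith [hg.1, hg.2]
    | succ k ih =>
      intro n
      obtain ⟨-, h0, h1⟩ := gaussIter_irrational_and_mem hθ h01 n
      have hinv := inv_gaussIter hθ h01 n
      rw [ha n, Nat.cast_one] at hinv
      have hx : gaussIter θ n * (1 + gaussIter θ (n + 1)) = 1 := by
        rw [← hinv, mul_inv_cancel₀ h0.ne']
      have hdiff : gaussIter θ n - g = -(gaussIter θ n * g) * (gaussIter θ (n + 1) - g) := by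
        linear_combination g * hx - gaussIter θ n * hg2
      rw [hdiff, abs_mul, abs_neg, abs_of_pos (mul_pos h0 hg.1), pow_succ']
      exact mul_le_mul (mul_le_of_le_one_left hg.1.le h1.le) (ih _) (abs_nonneg _) hg.1.le
  have hlim := tendsto_pow_atTop_nhds_zero_of_lt_one hg.1.le hg.2
  exact sub_eq_zero.1 (abs_nonpos_iff.1 (ge_of_tendsto' hlim fun k => hbound k n))

lemma mul_maxGap_le_of_mem_SB_one (hθ : θ ∈ SB 1) :
    N * maxGap θ N ≤ 1 + Real.sqrt (4 / 5) := by
  obtain ⟨hirr, h01, hbd⟩ := hθ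
  have ha (n : ℕ) : partQuot θ n = 1 :=
    (hbd.partQuot_le hirr h01 n).antisymm (partQuot_pos hirr h01 n)
  obtain ⟨n, m, hm, hma, hlow, hup⟩ := exists_intermediate_denom hirr h01 (M := N + 1) (by omega)
  obtain rfl : m = 1 := le_antisymm (hma.trans (ha n).le) hm
  have hH := maxGap_le_convErr hirr h01 hm hma hlow
  have h5 : Real.sqrt 5 ^ 2 = 5 := Real.sq_sqrt (by norm_num)
  have h5pos : 0 < Real.sqrt 5 := by positivity
  obtain ⟨g, hg⟩ : ∃ g : ℝ, Real.sqrt 5 = 2 * g + 1 := ⟨(Real.sqrt 5 - 1) / 2, by ring⟩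
  rw [hg] at h5 h5pos
  have hg2 : g * (1 + g) = 1 := by linarith
  have hgpos : 0 < g := by
    by_contra! hneg
    nlinarith
  have hg1 : g < 1 := by nlinarith
  have hsqrt : Real.sqrt (4 / 5) * (2 * g + 1) = 2 := by
    rw [← hg, ← Real.sqrt_mul (by norm_num), show (4 / 5 * 5 : ℝ) = 2 ^ 2 by norm_num,
      Real.sqrt_sq (by norm_num)]
  have hE (k : ℕ) : convErr θ k = g ^ k := by
    induction k with
    | zero => rfl
    | succ k ih =>
      rw [convErr, ih, gaussIter_eq_of_partQuot_eq_one ⟨hgpos, hg1⟩ hg2 hirr h01 ha, pow_succ']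
  have hQ (k : ℕ) : (convDenom θ (k + 1) : ℝ) - (1 + g) * convDenom θ k = (-g) ^ k := by
    induction k with
    | zero => simp [convDenom]
    | succ k ih =>
      rw [convDenom, ha k]
      push_cast
      linear_combination (-g) * ih - convDenom θ k * hg2
  have hdet := convDenom_mul_convErr hirr h01 n
  have hw := hQ n
  rw [hE] at hH hdet
  rw [hE] at hdet
  have hN : (N : ℝ) ≤ 2 * convDenom θ (n + 1) + convDenom θ n - 2 := by
    have : N + 2 ≤ 2 * convDenom θ (n + 1) + convDenom θ n := by omega
    have : (N : ℝ) + 2 ≤ 2 * convDenom θ (n + 1) + convDenom θ n := by exact_mod_cast this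
    linarith
  have hu : 0 < g ^ n := pow_pos hgpos n
  have hw_le : (-g) ^ n * g ^ n ≤ g ^ n := by
    refine mul_le_of_le_one_left hu.le ((le_abs_self _).trans ?_)
    rw [abs_pow, abs_neg, abs_of_pos hgpos]
    exact pow_le_one₀ hgpos.le hg1.le
  rw [pow_succ] at hdet
  have hH' : maxGap θ N ≤ g ^ n := by simpa using hH
  generalize (-g) ^ n = w at *
  generalize g ^ n = u at *
  generalize (convDenom θ (n + 1) : ℝ) = q₁ at *
  generalize (convDenom θ n : ℝ) = q₀ at *
  calc N * maxGap θ N ≤ N * u := by gcongr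
    _ ≤ (2 * q₁ + q₀ - 2) * u := by gcongr
    _ ≤ 1 + Real.sqrt (4 / 5) := by
      refine le_of_mul_le_mul_right ?_ h5pos
      have hR : q₀ * u * (2 * g + 1) = 1 - w * u := by linear_combination hdet - u * hw
      have key : (2 * q₁ + q₀ - 2) * u * (2 * g + 1) =
          2 * (2 * g + 1) + (1 - 2 * g) * (1 - w * u) - 2 * u * (2 * g + 1) := by
        linear_combination 2 * (2 * g + 1) * hdet + (1 - 2 * g) * hR
      rw [key, add_mul, hsqrt]
      nlinarith [mul_nonneg hgpos.le (sub_nonneg.2 hw_le)]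

lemma mul_maxGap_le (hB : 1 ≤ B) (hθ : θ ∈ SB B) :
    N * maxGap θ N ≤ (1 + Real.sqrt (4 / 5)) * B := by
  rcases hB.eq_or_lt with rfl | hB
  · simpa using mul_maxGap_le_of_mem_SB_one hθ
  · refine (mul_maxGap_le_of_two_le hB hθ).trans ?_
    have : (1 / 2 : ℝ) ≤ Real.sqrt (4 / 5) := Real.le_sqrt_of_sq_le (by norm_num)
    gcongr
    linarith

end UpperBound

/-- The number `θ = [0; B, B, B, …]` lies in `S_B` and satisfies `θ (B + θ) = 1`. -/
lemma exists_mem_SB_mul_eq_one {B : ℕ} (hB : 1 ≤ B) : ∃ θ ∈ SB B, θ * (B + θ) = 1 := by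
  have hB' : (1 : ℝ) ≤ B := by exact_mod_cast hB
  have hsq : Real.sqrt ((B ^ 2 + 4 : ℕ) : ℝ) ^ 2 = B ^ 2 + 4 := by
    rw [Real.sq_sqrt (by positivity)]
    push_cast
    rfl
  have hirr : Irrational (Real.sqrt ((B ^ 2 + 4 : ℕ) : ℝ)) := by
    rw [irrational_sqrt_natCast_iff]
    rintro ⟨r, hr⟩
    rcases (show r ≤ B ∨ r = B + 1 ∨ B + 2 ≤ r by omega) with h | rfl | h
    · nlinarith
    · have : 2 * B + 1 = 4 := by linarith
      omega
    · nlinarith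
  obtain ⟨θ, hθ⟩ : ∃ θ : ℝ, θ = (Real.sqrt ((B ^ 2 + 4 : ℕ) : ℝ) - B) / 2 := ⟨_, rfl⟩
  have hmul : θ * (B + θ) = 1 := by rw [hθ]; linarith
  have hθirr : Irrational θ := by
    rw [hθ]
    exact_mod_cast (hirr.sub_natCast B).div_natCast (m := 2) two_ne_zero
  have h0 : 0 < θ := by
    rw [hθ]
    nlinarith [Real.sqrt_nonneg ((B ^ 2 + 4 : ℕ) : ℝ)]
  have h1 : θ < 1 := by nlinarith
  have hinv : θ⁻¹ = B + θ := inv_eq_of_mul_eq_one_right hmul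
  have hiter (n : ℕ) : gaussIter θ n = θ := by
    induction n with
    | zero => rfl
    | succ n ih =>
      rw [gaussIter, ih, hinv, Int.fract_natCast_add, Int.fract_eq_self.2 ⟨h0.le, h1⟩]
  refine ⟨θ, ⟨hθirr, ⟨h0, h1⟩, fun i a hi => ?_⟩, hmul⟩
  rw [partDens_get?_eq_partQuot hθirr ⟨h0, h1⟩, Option.mem_some_iff, partQuot, hiter, hinv] at hi
  have hfloor := inv_gaussIter hθirr ⟨h0, h1⟩ i
  rw [hiter, hiter, partQuot, hiter, hinv] at hfloor
  linarith

lemma exists_div_four_le_mul_maxGap {B : ℕ} (hB : 1 ≤ B) :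
    ∃ θ ∈ SB B, ∃ N : ℕ, 1 ≤ N ∧ (B : ℝ) / 4 ≤ N * maxGap θ N := by
  obtain ⟨θ, hθ, hmul⟩ := exists_mem_SB_mul_eq_one hB
  obtain ⟨-, ⟨h0, h1⟩, -⟩ := id hθ
  rcases Nat.even_or_odd' B with ⟨a, rfl | rfl⟩
  · have ha : (1 : ℝ) ≤ a := by exact_mod_cast (by omega : 1 ≤ a)
    push_cast at *
    have hlt : a * θ < 1 / 2 := by nlinarith
    have := one_sub_mul_le_maxGap (N := a) h0 (by linarith)
    exact ⟨θ, hθ, a, by omega, by nlinarith⟩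
  · have ha : (0 : ℝ) ≤ a := by positivity
    push_cast at *
    have hlt : ((a + 1 : ℕ) : ℝ) * θ < 1 := by
      push_cast
      rcases Nat.eq_zero_or_pos a with rfl | hpos
      · simpa using h1
      · have : (1 : ℝ) ≤ a := by exact_mod_cast hpos
        nlinarith
    have hgap := one_sub_mul_le_maxGap h0 hlt
    refine ⟨θ, hθ, a + 1, by omega, ?_⟩
    push_cast at *
    have hkey : 1 ≤ θ * (2 * a + 3) := by nlinarith
    have hup : 4 * (a + 1) ^ 2 * θ ≤ 2 * a + 3 := by
      nlinarith
    nlinarith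

/-- **Corollary.**  For every integer `B ≥ 1`, `B/4 ≤ f(B) ≤ (1 + √(4/5))·B`. -/
theorem badF_bounds (B : ℕ) (hB : 1 ≤ B) :
    (B : ℝ) / 4 ≤ badF B ∧ badF B ≤ (1 + Real.sqrt (4 / 5)) * (B : ℝ) := by
  constructor
  · obtain ⟨θ, hθ, N, hN, h⟩ := exists_div_four_le_mul_maxGap hB
    refine h.trans (le_csSup ⟨(1 + Real.sqrt (4 / 5)) * B, ?_⟩ ⟨θ, hθ, N, hN, rfl⟩)
    rintro x ⟨θ, hθ, N, -, rfl⟩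
    exact mul_maxGap_le hB hθ
  · refine Real.sSup_le ?_ (by positivity)
    rintro x ⟨θ, hθ, N, -, rfl⟩
    exact mul_maxGap_le hB hθ
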